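/- (Theorem 4.2, trajectory form) Let n ≥ 2, 0 < r ≤ T, 0 ≤ Θ < 1, and let γ̃_{i,j} (i ≠ j, i,j = 1,…,n) be functions of class N. Suppose there exists ω > 1 such that the cyclic small-gain conditions (3.15) hold for γ_{i,j}(s) := ω·γ̃_{i,j}(ω s). Let x_i : [−T,∞) → ℝ^{k_i} (i = 1,…,n) be bounded functions such that for every t ≥ 0 and every i there exists θ ∈ [0,Θ] with |x_i(t)| ≤ θ·‖x_i‖_{[t−T,t−r]} + (1−θ)·max_{j≠i} γ̃_{i,j}(‖x_j‖_{[t−T,t]}) (note the gain term uses the norm over the full window [t−T,t], corresponding to Rational-Consistent Backward-looking expectations). Then lim_{t→∞} x_i(t) = 0 for every i; moreover, for every ε > 0 there exists δ > 0 such that every such family (x_1,…,x_n) with max_i ‖x_i‖_{[−T,0]} ≤ δ satisfies |x_i(t)| ≤ ε for all t ≥ 0 and all i. -/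

import Mathlib

open scoped BigOperators

/-- Euclidean norm of a vector in ℝ^m. -/
noncomputable def eNorm {m : ℕ} (v : Fin m → ℝ) : ℝ := Real.sqrt (∑ i, (v i) ^ 2)

/-- Sup (over [α, β]) of the Euclidean norm of a vector-valued signal. -/
noncomputable def vNorm {m : ℕ} (x : ℝ → Fin m → ℝ) (α β : ℝ) : ℝ :=
  sSup ((fun τ => eNorm (x τ)) '' Set.Icc α β)

/-- Max over indices `j ≠ i` of a finite family of reals (as a supremum). -/
noncomputable def maxNe {n : ℕ} (i : Fin n) (g : Fin n → ℝ) : ℝ :=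
  sSup {y | ∃ j, j ≠ i ∧ y = g j}

/-- A function `γ : [0,∞) → [0,∞)` of class N: continuous, non-decreasing, `γ(0)=0`. -/
def ClassN (γ : ℝ → ℝ) : Prop :=
  ContinuousOn γ (Set.Ici 0) ∧ MonotoneOn γ (Set.Ici 0) ∧ γ 0 = 0 ∧ ∀ s, 0 ≤ s → 0 ≤ γ s

/-- The cyclic composition `γ_{ι 0, ι 1} ∘ γ_{ι 1, ι 2} ∘ ⋯ ∘ γ_{ι (p-1), ι 0}`. -/
noncomputable def cyclicComp {n p : ℕ} (γ : Fin n → Fin n → ℝ → ℝ) (ι : Fin p → Fin n) :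
    ℝ → ℝ :=
  (List.ofFn (fun j : Fin p =>
    γ (ι j) (ι ⟨(j.1 + 1) % p, Nat.mod_lt _ j.pos⟩))).foldr (· ∘ ·) id

/-- Admissible trajectory for the uncertain small-gain model (3.9):
bounded, and satisfying the convex-combination estimate with gains `γ̃_{i,j}` over the
full window `[t-T, t]` for the gain terms (Rational-Consistent Backward-looking expectations), while the own-state term uses the delayed window `[t-T, t-r]`. -/
def SGTrajRC (n : ℕ) (k : Fin n → ℕ) (r T Θ : ℝ) (γ : Fin n → Fin n → ℝ → ℝ)
    (x : (i : Fin n) → ℝ → Fin (k i) → ℝ) : Prop :=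
  (∃ M : ℝ, ∀ i, ∀ t, -T ≤ t → eNorm (x i t) ≤ M) ∧
  (∀ t, 0 ≤ t → ∀ i, ∃ θ, θ ∈ Set.Icc 0 Θ ∧
    eNorm (x i t) ≤ θ * vNorm (x i) (t - T) (t - r) +
      (1 - θ) * maxNe i (fun j => γ i j (vNorm (x j) (t - T) t)))

open Filter Topology

lemma eNorm_nonneg {m : ℕ} (v : Fin m → ℝ) : 0 ≤ eNorm v := Real.sqrt_nonneg _

lemma vNorm_nonneg {m : ℕ} (x : ℝ → Fin m → ℝ) (α β : ℝ) : 0 ≤ vNorm x α β := by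
  refine Real.sSup_nonneg ?_
  rintro _ ⟨τ, -, rfl⟩
  exact eNorm_nonneg _

lemma vNorm_le {m : ℕ} {x : ℝ → Fin m → ℝ} {α β B : ℝ} (hαβ : α ≤ β)
    (h : ∀ τ ∈ Set.Icc α β, eNorm (x τ) ≤ B) : vNorm x α β ≤ B := by
  refine csSup_le ((Set.nonempty_Icc.2 hαβ).image _) ?_
  rintro _ ⟨τ, hτ, rfl⟩
  exact h τ hτ

lemma eNorm_le_vNorm {m : ℕ} {x : ℝ → Fin m → ℝ} {α β τ B : ℝ}
    (h : ∀ τ ∈ Set.Icc α β, eNorm (x τ) ≤ B) (hτ : τ ∈ Set.Icc α β) :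
    eNorm (x τ) ≤ vNorm x α β := by
  refine le_csSup ⟨B, ?_⟩ ⟨τ, hτ, rfl⟩
  rintro _ ⟨τ, hτ, rfl⟩
  exact h τ hτ

lemma maxNe_le {n : ℕ} (hn : 2 ≤ n) {i : Fin n} {g : Fin n → ℝ} {c : ℝ}
    (h : ∀ j, j ≠ i → g j ≤ c) : maxNe i g ≤ c := by
  have : Nontrivial (Fin n) := Fin.nontrivial_iff_two_le.2 hn
  obtain ⟨j, hj⟩ := exists_ne i
  refine csSup_le ⟨g j, j, hj, rfl⟩ ?_
  rintro _ ⟨j, hj, rfl⟩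
  exact h j hj

lemma ClassN.continuous_max {γ : ℝ → ℝ} (h : ClassN γ) : Continuous fun s => γ (max s 0) :=
  h.1.comp_continuous (by fun_prop) fun _ => Set.mem_Ici.2 (le_max_right _ _)

lemma ClassN.mono {γ : ℝ → ℝ} (h : ClassN γ) {a b : ℝ} (ha : 0 ≤ a) (hab : a ≤ b) : γ a ≤ γ b :=
  h.2.1 ha (ha.trans hab) hab

/-- A chain of gain inequalities bounds its start by the composition applied to its end. -/
lemma le_foldr_comp_ofFn {p : ℕ} (g : Fin p → ℝ → ℝ) (v : ℕ → ℝ) (hv : ∀ m, 0 ≤ v m)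
    (hmono : ∀ j, MonotoneOn (g j) (Set.Ici 0)) (h : ∀ j : Fin p, v j ≤ g j (v (j + 1))) :
    v 0 ≤ (List.ofFn g).foldr (· ∘ ·) id (v p) := by
  induction p generalizing v with
  | zero => simp
  | succ p ih =>
    have := ih (fun j => g j.succ) (fun m => v (m + 1)) (fun m => hv _) (fun j => hmono _)
      (fun j => by simpa using h j.succ)
    rw [List.ofFn_succ, List.foldr_cons]
    exact (h 0).trans (hmono 0 (hv _) ((hv _).trans this) (by simpa using this))

/-- A continuous monotone majorant of the identity and of all the gains. -/
noncomputable def gainMajorant {n : ℕ} (γ : Fin n → Fin n → ℝ → ℝ) (s : ℝ) : ℝ :=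
  max s 0 + ∑ i, ∑ j, if i = j then 0 else γ i j (max s 0)

lemma gain_term_nonneg {n : ℕ} {γ : Fin n → Fin n → ℝ → ℝ}
    (hγ : ∀ i j, i ≠ j → ClassN (γ i j)) (s : ℝ) (i j : Fin n) : 0 ≤ if i = j then 0 else γ i j (max s 0) := by
  split_ifs with h
  · rfl
  · exact (hγ i j h).2.2.2 _ (le_max_right _ _)

lemma continuous_gainMajorant {n : ℕ} {γ : Fin n → Fin n → ℝ → ℝ}
    (hγ : ∀ i j, i ≠ j → ClassN (γ i j)) : Continuous (gainMajorant γ) := by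
  refine (continuous_id.max continuous_const).add
    (continuous_finsetSum _ fun i _ => continuous_finsetSum _ fun j _ => ?_)
  split_ifs with h
  · exact continuous_const
  · exact (hγ i j h).continuous_max

lemma monotone_gainMajorant {n : ℕ} {γ : Fin n → Fin n → ℝ → ℝ}
    (hγ : ∀ i j, i ≠ j → ClassN (γ i j)) : Monotone (gainMajorant γ) := by
  intro a b hab
  have hm : max a 0 ≤ max b 0 := max_le_max_right _ hab
  refine add_le_add hm (Finset.sum_le_sum fun i _ => Finset.sum_le_sum fun j _ => ?_)
  split_ifs with h
  · rfl
  · exact (hγ i j h).mono (le_max_right _ _) hm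

lemma gainMajorant_zero {n : ℕ} {γ : Fin n → Fin n → ℝ → ℝ}
    (hγ : ∀ i j, i ≠ j → ClassN (γ i j)) : gainMajorant γ 0 = 0 := by
  simp only [gainMajorant, max_self, zero_add]
  refine Finset.sum_eq_zero fun i _ => Finset.sum_eq_zero fun j _ => ?_
  split_ifs with h
  · rfl
  · exact (hγ i j h).2.2.1

lemma id_le_gainMajorant {n : ℕ} {γ : Fin n → Fin n → ℝ → ℝ}
    (hγ : ∀ i j, i ≠ j → ClassN (γ i j)) : id ≤ gainMajorant γ := fun s =>
  (le_max_left s 0).trans <| le_add_of_nonneg_right <|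
    Finset.sum_nonneg fun i _ => Finset.sum_nonneg fun j _ => gain_term_nonneg hγ s i j

lemma gain_le_gainMajorant {n : ℕ} {γ : Fin n → Fin n → ℝ → ℝ}
    (hγ : ∀ i j, i ≠ j → ClassN (γ i j)) {i j : Fin n} (hij : i ≠ j) {s : ℝ} (hs : 0 ≤ s) :
    γ i j s ≤ gainMajorant γ s := by
  have h₁ := Finset.single_le_sum (f := fun j => if i = j then 0 else γ i j (max s 0))
    (fun j _ => gain_term_nonneg hγ s i j) (Finset.mem_univ j)
  have h₂ := Finset.single_le_sum (f := fun i => ∑ j, if i = j then 0 else γ i j (max s 0))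
    (fun i _ => Finset.sum_nonneg fun j _ => gain_term_nonneg hγ s i j) (Finset.mem_univ i)
  simp only [if_neg hij, max_eq_left hs] at h₁
  simp only [gainMajorant, max_eq_left hs] at h₂ ⊢
  linarith

/-- The cyclic small-gain conditions exclude cycles of gain inequalities among positive
quantities, so every quantity is controlled by `a` through at most `n` gains. -/
lemma le_iterate_gainMajorant {n : ℕ} {γ : Fin n → Fin n → ℝ → ℝ}
    (hγ : ∀ i j, i ≠ j → ClassN (γ i j)) {ω : ℝ} (hω : 1 ≤ ω)
    (hSG : ∀ p : ℕ, 2 ≤ p → p ≤ n → ∀ ι : Fin p → Fin n, Function.Injective ι →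
      ∀ s : ℝ, 0 < s → cyclicComp (fun i j s => ω * γ i j (ω * s)) ι s < s)
    {S : Fin n → ℝ} {a : ℝ} (ha : 0 ≤ a) (hS : ∀ i, 0 ≤ S i)
    (h : ∀ i, S i ≤ a ∨ ∃ j, j ≠ i ∧ S i ≤ γ i j (S j)) (i : Fin n) :
    S i ≤ (gainMajorant γ)^[n] a := by
  have hex : ∀ i, ∃ j, a < S i → j ≠ i ∧ S i ≤ γ i j (S j) := by
    intro i
    rcases h i with h | ⟨j, hj⟩
    · exact ⟨i, fun h' => absurd h h'.not_ge⟩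
    · exact ⟨j, fun _ => hj⟩
  choose f hf using hex
  have hmon : ∀ m, a ≤ (gainMajorant γ)^[m] a := fun m =>
    Function.id_le_iterate_of_id_le (id_le_gainMajorant hγ) m a
  have hpath : ∀ m i, S (f^[m] i) ≤ a → S i ≤ (gainMajorant γ)^[m] a := by
    intro m
    induction m with
    | zero => intro i hi; simpa using hi
    | succ m ih =>
      intro i hi
      rcases le_or_gt (S i) a with hia | hia
      · exact hia.trans (hmon _)
      · obtain ⟨hne, hle⟩ := hf i hia
        rw [Function.iterate_succ_apply']
        exact hle.trans ((gain_le_gainMajorant hγ hne.symm (hS _)).trans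
          (monotone_gainMajorant hγ (ih _ hi)))
  obtain ⟨m, hmn, hm⟩ : ∃ m ≤ n, S (f^[m] i) ≤ a := by
    by_contra! hcon
    obtain ⟨p, q, hpq, heq⟩ : ∃ p q : Fin (n + 1), p ≠ q ∧ f^[p] i = f^[q] i :=
      Fintype.exists_ne_map_eq_of_card_lt (fun p : Fin (n + 1) => f^[p] i) (by simp)
    wlog hlt : p < q generalizing p q
    · exact this q p hpq.symm heq.symm (lt_of_le_of_ne (not_lt.1 hlt) hpq.symm)
    set v := f^[p] i with hv
    have hper : Function.IsPeriodicPt f (q - p : ℕ) v := by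
      rw [Function.IsPeriodicPt, Function.IsFixedPt, hv, ← Function.iterate_add_apply,
        Nat.sub_add_cancel hlt.le, ← heq]
    set P := Function.minimalPeriod f v with hP
    have hPpos : 0 < P := hper.minimalPeriod_pos (Nat.sub_pos_of_lt hlt)
    have hPle : P ≤ q - p := hper.minimalPeriod_le (Nat.sub_pos_of_lt hlt)
    have hbig : ∀ m < P, a < S (f^[m] v) := by
      intro m hmP
      rw [hv, ← Function.iterate_add_apply]
      exact hcon _ (by omega)
    have hP1 : P ≠ 1 := by
      intro h1
      exact (hf v (hbig 0 hPpos)).1 (Function.minimalPeriod_eq_one_iff_isFixedPt.1 h1)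
    let ι : Fin P → Fin n := fun m => f^[m] v
    have hι : Function.Injective ι := fun m m' hmm =>
      Fin.ext (Function.iterate_injOn_Iio_minimalPeriod m.2 m'.2 hmm)
    have hPn : P ≤ n := by simpa using Fintype.card_le_of_injective ι hι
    have hnext : ∀ m, f^[m % P] v = f^[m] v := fun m => Function.iterate_mod_minimalPeriod_eq
    have hne : ∀ j : Fin P, ι j ≠ ι ⟨(j.1 + 1) % P, Nat.mod_lt _ j.pos⟩ := by
      intro j
      simp only [ι, hnext, Function.iterate_succ_apply']
      exact (hf _ (hbig j j.2)).1.symm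
    have hω0 : 0 ≤ ω := zero_le_one.trans hω
    have hchain := le_foldr_comp_ofFn
      (fun j : Fin P => fun s => ω * γ (ι j) (ι ⟨(j.1 + 1) % P, Nat.mod_lt _ j.pos⟩) (ω * s))
      (fun m => S (f^[m] v)) (fun m => hS _)
      (fun j s hs t ht hst => mul_le_mul_of_nonneg_left
        ((hγ _ _ (hne j)).mono (mul_nonneg hω0 hs) (mul_le_mul_of_nonneg_left hst hω0)) hω0)
      (fun j => by
        have hle := (hf _ (hbig j j.2)).2
        have hN := hγ _ _ (hne j)
        simp only [ι, hnext, Function.iterate_succ_apply'] at hN ⊢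
        refine hle.trans ((hN.mono (hS _) (le_mul_of_one_le_left (hS _) hω)).trans ?_)
        exact le_mul_of_one_le_left (hN.2.2.2 _ (mul_nonneg hω0 (hS _))) hω)
    have hvP : f^[P] v = v := Function.iterate_minimalPeriod
    simp only [Function.iterate_zero, id_eq, hvP] at hchain
    exact (hSG P (by omega) hPn ι hι (S v) (ha.trans_lt (hbig 0 hPpos))).not_ge hchain
  exact (hpath m i hm).trans
    (Function.monotone_iterate_of_id_le (id_le_gainMajorant hγ) hmn a)

/-- One step of the trajectory inequality, with all windows replaced by upper bounds. -/
lemma SGTrajRC.eNorm_le {n : ℕ} (hn : 2 ≤ n) {k : Fin n → ℕ} {r T Θ : ℝ} (hr : 0 ≤ r)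
    (hrT : r ≤ T) (hΘ1 : Θ ≤ 1) {γ : Fin n → Fin n → ℝ → ℝ}
    (hγ : ∀ i j, i ≠ j → ClassN (γ i j)) {x : (i : Fin n) → ℝ → Fin (k i) → ℝ}
    (hx : SGTrajRC n k r T Θ γ x) {t : ℝ} (ht : 0 ≤ t) {B : Fin n → ℝ}
    (hB : ∀ j, ∀ τ ∈ Set.Icc (t - T) t, eNorm (x j τ) ≤ B j) {i : Fin n} {c : ℝ}
    (hc : ∀ j, j ≠ i → γ i j (B j) ≤ c) (hcB : c ≤ B i) :
    eNorm (x i t) ≤ Θ * B i + (1 - Θ) * c := by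
  obtain ⟨θ, ⟨hθ0, hθ⟩, h⟩ := hx.2 t ht i
  have h₁ : vNorm (x i) (t - T) (t - r) ≤ B i :=
    vNorm_le (by linarith) fun τ hτ => hB i τ ⟨hτ.1, by linarith [hτ.2]⟩
  have h₂ : maxNe i (fun j => γ i j (vNorm (x j) (t - T) t)) ≤ c :=
    maxNe_le hn fun j hj => ((hγ i j hj.symm).mono (vNorm_nonneg _ _ _)
      (vNorm_le (by linarith) (hB j))).trans (hc j hj)
  nlinarith [mul_le_mul_of_nonneg_left h₁ hθ0,
    mul_le_mul_of_nonneg_left h₂ (by linarith : 0 ≤ 1 - θ),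
    mul_nonneg (sub_nonneg.2 hθ) (sub_nonneg.2 hcB)]

lemma exists_lt_of_forall_gain_lt {n : ℕ} {i : Fin n} {g : Fin n → ℝ} {s : ℝ}
    (h : ∀ j, j ≠ i → g j < s) : ∃ c < s, ∀ j, j ≠ i → g j < c := by
  have : ∀ᶠ c in 𝓝[<] s, ∀ j, j ≠ i → g j < c :=
    eventually_all.2 fun j => by
      by_cases hj : j = i
      · exact Eventually.of_forall fun c hc => absurd hj hc
      · filter_upwards [mem_nhdsWithin_of_mem_nhds (lt_mem_nhds (h j hj))] with c hc _ using hc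
  obtain ⟨c, hc, hcs⟩ := (this.and self_mem_nhdsWithin).exists
  exact ⟨c, hcs, hc⟩

/-- Suprema over the whole time axis satisfy the gain inequalities up to the initial data. -/
lemma SGTrajRC.sSup_le_or {n : ℕ} (hn : 2 ≤ n) {k : Fin n → ℕ} {r T Θ : ℝ} (hr : 0 ≤ r)
    (hrT : r ≤ T) (hΘ1 : Θ < 1) {γ : Fin n → Fin n → ℝ → ℝ}
    (hγ : ∀ i j, i ≠ j → ClassN (γ i j)) {x : (i : Fin n) → ℝ → Fin (k i) → ℝ}
    (hx : SGTrajRC n k r T Θ γ x) {a : ℝ}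
    (ha : ∀ i, ∀ τ ∈ Set.Icc (-T) 0, eNorm (x i τ) ≤ a) (i : Fin n) :
    sSup ((fun τ => eNorm (x i τ)) '' Set.Ici (-T)) ≤ a ∨
      ∃ j, j ≠ i ∧ sSup ((fun τ => eNorm (x i τ)) '' Set.Ici (-T)) ≤
        γ i j (sSup ((fun τ => eNorm (x j τ)) '' Set.Ici (-T))) := by
  obtain ⟨M, hM⟩ := hx.1
  set S : Fin n → ℝ := fun i => sSup ((fun τ => eNorm (x i τ)) '' Set.Ici (-T)) with hS
  have hxS : ∀ j, ∀ τ ≥ -T, eNorm (x j τ) ≤ S j := by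
    intro j τ hτ
    refine le_csSup ⟨M, ?_⟩ ⟨τ, hτ, rfl⟩
    rintro _ ⟨τ, hτ, rfl⟩
    exact hM j τ hτ
  by_contra! hcon
  obtain ⟨hai, hgain⟩ := hcon
  obtain ⟨c, hcS, hc⟩ := exists_lt_of_forall_gain_lt hgain
  have hle : S i ≤ max a (Θ * S i + (1 - Θ) * c) := by
    refine csSup_le (Set.nonempty_Ici.image _) ?_
    rintro _ ⟨τ, hτ, rfl⟩
    rcases le_total τ 0 with h0 | h0
    · exact le_max_of_le_left (ha i τ ⟨hτ, h0⟩)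
    · exact le_max_of_le_right (hx.eNorm_le hn hr hrT hΘ1.le hγ h0
        (fun j σ hσ => hxS j σ (by linarith [hσ.1])) (fun j hj => (hc j hj).le) hcS.le)
  rcases le_max_iff.1 hle with h | h
  · exact h.not_gt hai
  · have hcS' : c < S i := hcS
    nlinarith

/-- Upper limits at infinity satisfy the gain inequalities. -/
lemma SGTrajRC.exists_limsup_le {n : ℕ} (hn : 2 ≤ n) {k : Fin n → ℕ} {r T Θ : ℝ} (hr : 0 ≤ r)
    (hrT : r ≤ T) (hΘ1 : Θ < 1) {γ : Fin n → Fin n → ℝ → ℝ}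
    (hγ : ∀ i j, i ≠ j → ClassN (γ i j)) {x : (i : Fin n) → ℝ → Fin (k i) → ℝ}
    (hx : SGTrajRC n k r T Θ γ x)
    (hbdd : ∀ i, IsBoundedUnder (· ≤ ·) atTop fun t => eNorm (x i t))
    (hcobdd : ∀ i, IsCoboundedUnder (· ≤ ·) atTop fun t => eNorm (x i t))
    (hL : ∀ i, 0 ≤ limsup (fun t => eNorm (x i t)) atTop) (i : Fin n) :
    ∃ j, j ≠ i ∧ limsup (fun t => eNorm (x i t)) atTop ≤
      γ i j (limsup (fun t => eNorm (x j t)) atTop) := by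
  set L : Fin n → ℝ := fun i => limsup (fun t => eNorm (x i t)) atTop with hLdef
  by_contra! hgain
  obtain ⟨c, hcL, hc⟩ := exists_lt_of_forall_gain_lt hgain
  have hcL' : c < L i := hcL
  have hη₁ : ∀ᶠ η in 𝓝[>] (0 : ℝ), ∀ j, j ≠ i → γ i j (max (L j + η) 0) < c := by
    refine eventually_all.2 fun j => ?_
    by_cases hj : j = i
    · exact Eventually.of_forall fun c hc => absurd hj hc
    · have hcont : Continuous fun η => γ i j (max (L j + η) 0) :=
        (hγ i j (Ne.symm hj)).continuous_max.comp (continuous_const.add continuous_id)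
      have h0 : γ i j (max (L j + 0) 0) < c := by
        rw [add_zero, max_eq_left (hL j)]
        exact hc j hj
      filter_upwards [mem_nhdsWithin_of_mem_nhds
        (hcont.continuousAt.eventually_lt_const h0)] with η hη _ using hη
  have hη₂ : ∀ᶠ η in 𝓝[>] (0 : ℝ), Θ * (L i + η) + (1 - Θ) * c < L i := by
    have hcont : Continuous fun η => Θ * (L i + η) + (1 - Θ) * c := by fun_prop
    refine mem_nhdsWithin_of_mem_nhds (hcont.continuousAt.eventually_lt_const ?_)
    nlinarith
  obtain ⟨η, ⟨h₁, h₂⟩, hη⟩ := ((hη₁.and hη₂).and self_mem_nhdsWithin).exists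
  have hη : 0 < η := hη
  have hev : ∀ᶠ t in atTop, ∀ j, eNorm (x j t) < L j + η :=
    eventually_all.2 fun j => eventually_lt_of_limsup_lt (lt_add_of_pos_right (L j) hη) (hbdd j)
  obtain ⟨N, hN⟩ := eventually_atTop.1 hev
  refine h₂.not_ge (limsup_le_of_le (hcobdd i) ?_)
  filter_upwards [eventually_ge_atTop 0, eventually_ge_atTop (N + T)] with t ht htN
  refine hx.eNorm_le hn hr hrT hΘ1.le hγ (B := fun j => L j + η) ht
    (fun j τ hτ => (hN τ (by linarith [hτ.1]) j).le) (fun j hj => ?_) (by linarith)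
  have := h₁ j hj
  rw [max_eq_left (by linarith [hL j])] at this
  exact this.le

/-- Theorem 4.2 (trajectory form): under the cyclic small-gain conditions (3.15) the origin
is robustly globally asymptotically stable: every admissible trajectory converges to 0, and
stability holds uniformly over all admissible uncertainties. -/
theorem smallgain_RGAS_rational (n : ℕ) (hn : 2 ≤ n) (r T Θ : ℝ) (hr : 0 < r) (hrT : r ≤ T)
    (hΘ0 : 0 ≤ Θ) (hΘ1 : Θ < 1) (k : Fin n → ℕ)
    (γt : Fin n → Fin n → ℝ → ℝ) (hγ : ∀ i j, i ≠ j → ClassN (γt i j))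
    (ω : ℝ) (hω : 1 < ω)
    (hSG : ∀ p : ℕ, 2 ≤ p → p ≤ n → ∀ ι : Fin p → Fin n, Function.Injective ι →
      ∀ s : ℝ, 0 < s → cyclicComp (fun i j s => ω * γt i j (ω * s)) ι s < s) :
    (∀ x : (i : Fin n) → ℝ → Fin (k i) → ℝ, SGTrajRC n k r T Θ γt x →
      ∀ i, ∀ ε > 0, ∃ M : ℝ, ∀ t ≥ M, eNorm (x i t) ≤ ε) ∧
    (∀ ε > 0, ∃ δ > 0, ∀ x : (i : Fin n) → ℝ → Fin (k i) → ℝ, SGTrajRC n k r T Θ γt x →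
      (∀ i, vNorm (x i) (-T) 0 ≤ δ) → ∀ t ≥ 0, ∀ i, eNorm (x i t) ≤ ε) := by
  have hzero : (gainMajorant γt)^[n] 0 = 0 := Function.iterate_fixed (gainMajorant_zero hγ) n
  constructor
  · intro x hx i ε hε
    obtain ⟨M, hM⟩ := hx.1
    have hbdd : ∀ i, IsBoundedUnder (· ≤ ·) atTop fun t => eNorm (x i t) := fun i =>
      ⟨M, eventually_map.2 ((eventually_ge_atTop (-T)).mono fun t ht => hM i t ht)⟩
    have hcobdd : ∀ i, IsCoboundedUnder (· ≤ ·) atTop fun t => eNorm (x i t) := fun i =>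
      IsBoundedUnder.isCoboundedUnder_le
        ⟨0, eventually_map.2 (Eventually.of_forall fun t => eNorm_nonneg (x i t))⟩
    have hL : ∀ i, 0 ≤ limsup (fun t => eNorm (x i t)) atTop := fun i =>
      le_limsup_of_frequently_le (Eventually.of_forall fun t => eNorm_nonneg (x i t)).frequently
        (hbdd i)
    have hle := le_iterate_gainMajorant hγ hω.le hSG le_rfl hL (fun i => Or.inr <|
      hx.exists_limsup_le hn hr.le hrT hΘ1 hγ hbdd hcobdd hL i) i
    rw [hzero] at hle
    obtain ⟨N, hN⟩ :=
      eventually_atTop.1 (eventually_lt_of_limsup_lt (hle.trans_lt hε) (hbdd i))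
    exact ⟨N, fun t ht => (hN t ht).le⟩
  · intro ε hε
    have hcont : ContinuousAt (gainMajorant γt)^[n] 0 :=
      ((continuous_gainMajorant hγ).iterate n).continuousAt
    have hev : ∀ᶠ δ in 𝓝[>] (0 : ℝ), (gainMajorant γt)^[n] δ < ε :=
      mem_nhdsWithin_of_mem_nhds (hcont.eventually_lt_const (by rwa [hzero]))
    obtain ⟨δ, hδε, hδ⟩ := (hev.and self_mem_nhdsWithin).exists
    have hδ : 0 < δ := hδ
    refine ⟨δ, hδ, fun x hx hinit t ht i => ?_⟩
    obtain ⟨M, hM⟩ := hx.1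
    have hS : ∀ i, 0 ≤ sSup ((fun τ => eNorm (x i τ)) '' Set.Ici (-T)) := by
      intro i
      refine Real.sSup_nonneg ?_
      rintro _ ⟨τ, -, rfl⟩
      exact eNorm_nonneg _
    have hle := le_iterate_gainMajorant hγ hω.le hSG hδ.le hS
      (hx.sSup_le_or hn hr.le hrT hΘ1 hγ fun i τ hτ =>
        (eNorm_le_vNorm (fun σ hσ => hM i σ hσ.1) hτ).trans (hinit i)) i
    have hbdd : BddAbove ((fun τ => eNorm (x i τ)) '' Set.Ici (-T)) := by
      refine ⟨M, ?_⟩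
      rintro _ ⟨τ, hτ, rfl⟩
      exact hM i τ hτ
    have hmem : t ∈ Set.Ici (-T) := Set.mem_Ici.2 (by linarith)
    exact (le_csSup hbdd (Set.mem_image_of_mem _ hmem)).trans (hle.trans hδε.le)
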